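/- arXiv:2007.06938 — 2 statements merged into one kernel-verified Lean document; each statement's English description precedes it below -/
import Mathlib

section
/- Let Λ be a symbol with odd defect, rank(Λ) = n and Υ(Λ) = [λ; μ]. Then there exists a symbol Λ' of rank n' with (Λ, Λ') ∈ B^+_{n,n'} if and only if n' ≥ n − λ_1 − (def(Λ) − 1)/2. -/
namespace GGP

/-- A *symbol* `Λ = (A; B)`: an ordered pair of finite sets of natural numbers. -/
structure Symbol where
  A : Finset ℕ
  B : Finset ℕ

namespace Symbol

/-- The rank of a symbol:
`rank(Λ) = Σ_{a∈A} a + Σ_{b∈B} b − ⌊((|A|+|B|−1)/2)²⌋ = Σ + Σ − ⌊(|A|+|B|−1)²/4⌋`. -/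
def rank (Λ : Symbol) : ℤ :=
  (∑ a ∈ Λ.A, (a : ℤ)) + (∑ b ∈ Λ.B, (b : ℤ))
    - ((Λ.A.card : ℤ) + (Λ.B.card : ℤ) - 1) ^ 2 / 4

/-- The defect of a symbol: `def(Λ) = |A| − |B| ∈ ℤ`. -/
def defect (Λ : Symbol) : ℤ := (Λ.A.card : ℤ) - (Λ.B.card : ℤ)

/-- The shift of a symbol: `(a_1,…,a_m; b_1,…,b_l) ↦ (a_1+1,…,a_m+1,0; b_1+1,…,b_l+1,0)`. -/
def shift (Λ : Symbol) : Symbol :=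
  ⟨insert 0 (Λ.A.image (· + 1)), insert 0 (Λ.B.image (· + 1))⟩

/-- Equivalence of symbols: one is obtained from the other by finitely many shifts. -/
def Equiv (Λ M : Symbol) : Prop :=
  ∃ k l : ℕ, shift^[k] Λ = shift^[l] M

end Symbol

/-- The partition associated to a finite set `A = {a_1 > … > a_m}` of naturals:
the function sending the index `i` (0-based, so `i` stands for the (i+1)-st part)
to `λ_{i+1} = a_{i+1} − (m − (i+1))`, with parts beyond the length equal to `0`. -/
def upsFun (A : Finset ℕ) : ℕ → ℕ := fun i =>
  if h : i < A.card then
    (A.sort (· ≤ ·))[A.card - 1 - i]'(by rw [Finset.length_sort]; omega)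
      - (A.card - 1 - i)
  else 0

/-- `|λ|`: the sum of the parts of a partition (given as a function). -/
noncomputable def psize (f : ℕ → ℕ) : ℕ := ∑ᶠ i, f i

/-- The transpose of a partition: `(ᵗλ)_{i+1} = #{ j : λ_{j+1} ≥ i+1 }` (0-based index `i`). -/
noncomputable def transposeFun (f : ℕ → ℕ) : ℕ → ℕ := fun i => Set.ncard {j | i + 1 ≤ f j}

/-- `λ ≼ μ` : `μ_i − 1 ≤ λ_i ≤ μ_i` for every `i`. -/
def Prec (f g : ℕ → ℕ) : Prop := ∀ i, g i - 1 ≤ f i ∧ f i ≤ g i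

/-- `λ²`: the partition obtained from `λ` by deleting one copy of its largest part. -/
def tailPart (f : ℕ → ℕ) : ℕ → ℕ := fun i => f (i + 1)

/-- A function `ℕ → ℕ` represents a partition iff it is antitone and eventually zero. -/
def IsPartitionFun (f : ℕ → ℕ) : Prop :=
  Antitone f ∧ ∃ N, ∀ i, N ≤ i → f i = 0

/-- `(Λ, Λ') ∈ B^+_{n,n'}`. -/
def BPlus (n n' : ℕ) (Λ Λ' : Symbol) : Prop :=
  Λ.rank = (n : ℤ) ∧ Λ'.rank = (n' : ℤ) ∧
    Prec (transposeFun (upsFun Λ'.B)) (transposeFun (upsFun Λ.A)) ∧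
    Prec (transposeFun (upsFun Λ.B)) (transposeFun (upsFun Λ'.A)) ∧
    Λ'.defect = -Λ.defect + 1

/-- `(Λ, Λ') ∈ B^−_{n,n'}`. -/
def BMinus (n n' : ℕ) (Λ Λ' : Symbol) : Prop :=
  Λ.rank = (n : ℤ) ∧ Λ'.rank = (n' : ℤ) ∧
    Prec (transposeFun (upsFun Λ'.A)) (transposeFun (upsFun Λ.B)) ∧
    Prec (transposeFun (upsFun Λ.A)) (transposeFun (upsFun Λ'.B)) ∧
    Λ'.defect = -Λ.defect - 1

/-- A symbol is reduced if not both rows contain `0`. -/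
def Reduced (Λ : Symbol) : Prop := ¬ (0 ∈ Λ.A ∧ 0 ∈ Λ.B)


theorem lt_transposeFun_iff {f : ℕ → ℕ} (hf : IsPartitionFun f) (i j : ℕ) :
    j < transposeFun f i ↔ i < f j := by
  classical
  obtain ⟨hanti, N, hN⟩ := hf
  have hex : ∃ k, f k ≤ i := ⟨N, by simp [hN N le_rfl]⟩
  have hlt : ∀ k, k < Nat.find hex ↔ i < f k := fun k => by
    refine ⟨fun h => not_le.1 (Nat.find_min hex h), fun h => ?_⟩
    by_contra! hk
    exact absurd ((hanti hk).trans (Nat.find_spec hex)) (not_le.2 h)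
  have hset : {k | i + 1 ≤ f k} = (Finset.range (Nat.find hex) : Set ℕ) := by
    ext k
    simp [hlt]
  rw [transposeFun, hset, Set.ncard_coe_finset, Finset.card_range, hlt]

/-- `ᵗf ≼ ᵗg` holds iff the skew shape `g / f` is a horizontal strip. -/
theorem prec_transposeFun_iff {f g : ℕ → ℕ} (hf : IsPartitionFun f) (hg : IsPartitionFun g) :
    Prec (transposeFun f) (transposeFun g) ↔ ∀ j, g (j + 1) ≤ f j ∧ f j ≤ g j := by
  constructor
  · refine fun h j => ⟨le_of_forall_lt fun i hi => ?_, le_of_forall_lt fun i hi => ?_⟩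
    · rw [← lt_transposeFun_iff hg] at hi
      rw [← lt_transposeFun_iff hf]
      have := (h i).1
      omega
    · rw [← lt_transposeFun_iff hf] at hi
      exact (lt_transposeFun_iff hg i j).1 (hi.trans_le (h i).2)
  · refine fun h i => ⟨le_of_forall_lt fun j hj => ?_, le_of_forall_lt fun j hj => ?_⟩
    · have hj' : j + 1 < transposeFun g i := by omega
      rw [lt_transposeFun_iff hg] at hj'
      exact (lt_transposeFun_iff hf i j).2 (hj'.trans_le (h j).1)
    · rw [lt_transposeFun_iff hf] at hj
      exact (lt_transposeFun_iff hg i j).2 (hj.trans_le (h j).2)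

theorem upsFun_of_lt (A : Finset ℕ) {i : ℕ} (h : i < A.card) :
    upsFun A i = A.orderEmbOfFin rfl ⟨A.card - 1 - i, by omega⟩ - (A.card - 1 - i) := by
  simp [upsFun, h, Finset.orderEmbOfFin_apply]

theorem upsFun_of_le (A : Finset ℕ) {i : ℕ} (h : A.card ≤ i) : upsFun A i = 0 := by
  simp [upsFun, not_lt.2 h]

theorem orderEmbOfFin_add_le (A : Finset ℕ) (k d : ℕ) (h : k + d < A.card) :
    A.orderEmbOfFin rfl ⟨k, by omega⟩ + d ≤ A.orderEmbOfFin rfl ⟨k + d, h⟩ := by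
  induction d with
  | zero => simp
  | succ d ih =>
    have hlt : A.orderEmbOfFin rfl ⟨k + d, by omega⟩ < A.orderEmbOfFin rfl ⟨k + (d + 1), h⟩ :=
      (A.orderEmbOfFin rfl).strictMono (by simp [Fin.lt_def])
    have := ih (by omega)
    omega

theorem le_orderEmbOfFin (A : Finset ℕ) (k : ℕ) (h : k < A.card) :
    k ≤ A.orderEmbOfFin rfl ⟨k, h⟩ := by
  have := orderEmbOfFin_add_le A 0 k (by omega)
  simp only [zero_add] at this
  omega

theorem isPartitionFun_upsFun (A : Finset ℕ) : IsPartitionFun (upsFun A) := by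
  refine ⟨antitone_nat_of_succ_le fun i => ?_, A.card, fun i => upsFun_of_le A⟩
  by_cases h : i + 1 < A.card
  · rw [upsFun_of_lt A h, upsFun_of_lt A (by omega)]
    have := orderEmbOfFin_add_le A (A.card - 1 - (i + 1)) 1 (by omega)
    have he : A.card - 1 - (i + 1) + 1 = A.card - 1 - i := by omega
    simp only [he] at this
    omega
  · simp [upsFun_of_le A (not_lt.1 h)]

theorem sum_eq_sum_upsFun (A : Finset ℕ) :
    ∑ a ∈ A, a = ∑ i ∈ Finset.range A.card, upsFun A i + ∑ i ∈ Finset.range A.card, i := by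
  rw [← Finset.sum_range_reflect (fun i => upsFun A i), ← Finset.sum_add_distrib,
    Finset.sum_range]
  conv_lhs => rw [← Finset.image_orderEmbOfFin_univ A rfl]
  rw [Finset.sum_image fun x _ y _ h => (A.orderEmbOfFin rfl).injective h]
  refine Finset.sum_congr rfl fun k _ => ?_
  obtain ⟨k, hk⟩ := k
  have he : A.card - 1 - (A.card - 1 - k) = k := by omega
  rw [upsFun_of_lt A (by simp only; omega)]
  simp only [he]
  have := le_orderEmbOfFin A k hk
  omega

theorem two_mul_sum_eq (A : Finset ℕ) {N : ℕ} (hN : A.card ≤ N) :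
    2 * ∑ a ∈ A, (a : ℤ)
      = 2 * ∑ i ∈ Finset.range N, (upsFun A i : ℤ) + (A.card : ℤ) * ((A.card : ℤ) - 1) := by
  have h0 : ∑ i ∈ Finset.range N, upsFun A i = ∑ i ∈ Finset.range A.card, upsFun A i :=
    (Finset.sum_subset (Finset.range_mono hN) fun i _ hi =>
      upsFun_of_le A (by simpa using hi)).symm
  have h1 := sum_eq_sum_upsFun A
  have h2 := Finset.sum_range_id_mul_two A.card
  have h3 : ((A.card * (A.card - 1) : ℕ) : ℤ) = (A.card : ℤ) * ((A.card : ℤ) - 1) := by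
    cases A.card <;> simp
  rw [← h3, ← h2]
  rw [← h0] at h1
  have h4 := congrArg (Nat.cast : ℕ → ℤ) h1
  push_cast at h4 ⊢
  linarith

theorem Symbol.rank_eq (Λ : Symbol) {N : ℕ} (hA : Λ.A.card ≤ N) (hB : Λ.B.card ≤ N) :
    Λ.rank = ∑ i ∈ Finset.range N, (upsFun Λ.A i : ℤ) + ∑ i ∈ Finset.range N, (upsFun Λ.B i : ℤ)
      + Λ.defect ^ 2 / 4 := by
  have h1 := two_mul_sum_eq Λ.A hA
  have h2 := two_mul_sum_eq Λ.B hB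
  rw [Symbol.rank, Symbol.defect]
  generalize (Λ.A.card : ℤ) = a at *
  generalize (Λ.B.card : ℤ) = b at *
  obtain ⟨x, rfl | rfl⟩ := Int.even_or_odd' a <;> obtain ⟨y, rfl | rfl⟩ := Int.even_or_odd' b <;>
    ring_nf at h1 h2 ⊢ <;> omega

theorem exists_upsFun_eq {f : ℕ → ℕ} (hf : Antitone f) {m : ℕ} (hm : ∀ i, m ≤ i → f i = 0) :
    ∃ A : Finset ℕ, A.card = m ∧ upsFun A = f := by
  set g : Fin m → ℕ := fun k => f (m - 1 - k) + k with hg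
  have hmono : StrictMono g := fun k l hkl => by
    have : f (m - 1 - k) ≤ f (m - 1 - l) := hf (by omega)
    have : (k : ℕ) < l := hkl
    simp only [hg]
    omega
  refine ⟨Finset.univ.image g, ?_, ?_⟩
  · rw [Finset.card_image_of_injective _ hmono.injective]
    simp
  generalize hA : Finset.univ.image g = A
  have hcard : A.card = m := by
    rw [← hA, Finset.card_image_of_injective _ hmono.injective]
    simp
  have hmem : ∀ x, g x ∈ A := fun x => hA ▸ Finset.mem_image_of_mem g (Finset.mem_univ x)
  clear hA
  subst hcard
  have hemb := Finset.orderEmbOfFin_unique rfl hmem hmono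
  funext i
  by_cases h : i < A.card
  · have he : A.card - 1 - (A.card - 1 - i) = i := by omega
    rw [upsFun_of_lt A h, ← hemb]
    simp [hg, he]
  · rw [upsFun_of_le A (not_lt.1 h), hm i (not_lt.1 h)]

theorem sum_range_succ_shift_upsFun (A : Finset ℕ) {N : ℕ} (hN : A.card ≤ N) :
    ∑ i ∈ Finset.range N, (upsFun A (i + 1) : ℤ)
      = ∑ i ∈ Finset.range N, (upsFun A i : ℤ) - (upsFun A 0 : ℤ) := by
  have h := Finset.sum_range_succ (fun i => (upsFun A i : ℤ)) N
  rw [Finset.sum_range_succ', upsFun_of_le A hN] at h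
  push_cast at h
  linarith

theorem sq_div_four_sub {d : ℤ} (hd : Odd d) :
    d ^ 2 / 4 - (d - 1) / 2 = (-d + 1) ^ 2 / 4 := by
  obtain ⟨k, rfl⟩ := hd
  ring_nf
  omega

/-- For a symbol `Λ` of odd defect, rank `n` and `Υ(Λ) = [λ; μ]`, there exists a
symbol `Λ'` of rank `n'` with `(Λ, Λ') ∈ B^+_{n,n'}` iff `n' ≥ n − λ_1 − (def(Λ)−1)/2`. -/
theorem statement7 (Λ : Symbol) (hodd : Odd Λ.defect) (n : ℕ) (hn : Λ.rank = (n : ℤ))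
    (n' : ℕ) :
    (∃ Λ' : Symbol, BPlus n n' Λ Λ') ↔
      (n : ℤ) - (upsFun Λ.A 0 : ℤ) - (Λ.defect - 1) / 2 ≤ (n' : ℤ) := by
  have hdef := sq_div_four_sub hodd
  constructor
  · rintro ⟨Λ', -, hn', h1, h2, hd⟩
    rw [prec_transposeFun_iff (isPartitionFun_upsFun _) (isPartitionFun_upsFun _)] at h1 h2
    obtain ⟨N, hN⟩ : ∃ N, N = Λ.A.card + Λ.B.card + Λ'.A.card + Λ'.B.card := ⟨_, rfl⟩
    rw [Λ.rank_eq (N := N) (by omega) (by omega)] at hn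
    rw [Λ'.rank_eq (N := N) (by omega) (by omega), hd] at hn'
    have hB : ∑ i ∈ Finset.range N, (upsFun Λ.A (i + 1) : ℤ)
        ≤ ∑ i ∈ Finset.range N, (upsFun Λ'.B i : ℤ) :=
      Finset.sum_le_sum fun i _ => by exact_mod_cast (h1 i).1
    have hA : ∑ i ∈ Finset.range N, (upsFun Λ.B i : ℤ)
        ≤ ∑ i ∈ Finset.range N, (upsFun Λ'.A i : ℤ) :=
      Finset.sum_le_sum fun i _ => by exact_mod_cast (h2 i).2
    rw [sum_range_succ_shift_upsFun Λ.A (by omega)] at hB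
    linarith
  · intro h
    obtain ⟨k, hk⟩ := Int.le.dest h
    set a := Λ.A.card with ha
    set b := Λ.B.card with hb
    have hdab : Λ.defect = (a : ℤ) - b := rfl
    obtain ⟨hantiA, -⟩ := isPartitionFun_upsFun Λ.A
    obtain ⟨hantiB, -⟩ := isPartitionFun_upsFun Λ.B
    obtain ⟨B', hB'card, hB'⟩ := exists_upsFun_eq (f := fun i => upsFun Λ.A (i + 1)) (m := a)
      (fun i j hij => hantiA (Nat.succ_le_succ hij)) fun i hi => upsFun_of_le _ (by omega)
    obtain ⟨A', hA'card, hA'⟩ := exists_upsFun_eq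
      (f := fun i => upsFun Λ.B i + if i = 0 then k else 0) (m := b + 1)
      (antitone_nat_of_succ_le fun i => by
        have := hantiB (Nat.le_succ i)
        simp only [Nat.succ_eq_add_one] at this
        simp only [Nat.add_eq_zero_iff, one_ne_zero, and_false, if_false]
        omega)
      fun i hi => by
        have : i ≠ 0 := by omega
        simp [this, upsFun_of_le Λ.B (i := i) (by omega)]
    have hd : (⟨A', B'⟩ : Symbol).defect = -Λ.defect + 1 := by
      rw [hdab, Symbol.defect]
      simp only [hA'card, hB'card]
      push_cast
      ring
    refine ⟨⟨A', B'⟩, hn, ?_, ?_, ?_, hd⟩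
    · rw [Λ.rank_eq (N := a + b + 1) (by omega) (by omega)] at hn
      rw [Symbol.rank_eq _ (N := a + b + 1) (by simp only; omega) (by simp only; omega), hd]
      simp only [hA', hB']
      rw [sum_range_succ_shift_upsFun Λ.A (by omega)]
      push_cast
      rw [Finset.sum_add_distrib, Finset.sum_ite_eq' (Finset.range (a + b + 1)) 0,
        if_pos (by simp)]
      linarith
    · rw [prec_transposeFun_iff (isPartitionFun_upsFun _) (isPartitionFun_upsFun _)]
      simp only [hB']
      exact fun j => ⟨le_rfl, hantiA (Nat.le_succ j)⟩
    · rw [prec_transposeFun_iff (isPartitionFun_upsFun _) (isPartitionFun_upsFun _)]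
      simp only [hA']
      exact fun j => ⟨by simpa using hantiB (Nat.le_succ j), Nat.le_add_right _ _⟩

end GGP
end

section
/- Let k be an even natural number, and set Λ = ({2k, 2k−1, …, 1, 0}; ∅), M = (∅; {2k−1, 2k−2, …, 1, 0}), and N = (∅; {2k+1, 2k, …, 1, 0}). Then rank(Λ) = k(k+1), def(Λ) = 2k+1, rank(M) = k², def(M) = −2k, rank(N) = (k+1)², def(N) = −(2k+2), and moreover (Λ, M) ∈ B^+_{k(k+1), k²} and (Λ, N) ∈ B^−_{k(k+1), (k+1)²}. -/
namespace GGP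

theorem upsFun_range (n : ℕ) : upsFun (Finset.range n) = fun _ => 0 := by
  funext i
  simp [upsFun, Finset.sort_range]

theorem upsFun_empty : upsFun ∅ = fun _ => 0 := upsFun_range 0

theorem prec_refl (f : ℕ → ℕ) : Prec f f := fun _ => ⟨Nat.sub_le _ _, le_rfl⟩

theorem sum_range_intCast_mul_two (n : ℕ) :
    (∑ a ∈ Finset.range n, (a : ℤ)) * 2 = n * (n - 1) := by
  induction n with
  | zero => simp
  | succ n ih => rw [Finset.sum_range_succ, add_mul, ih]; push_cast; ring

theorem rank_range_left (k : ℕ) :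
    Symbol.rank ⟨Finset.range (2 * k + 1), ∅⟩ = (k * (k + 1) : ℤ) := by
  have h := sum_range_intCast_mul_two (2 * k + 1)
  have hq : ((2 * k + 1 : ℤ) + 0 - 1) ^ 2 / 4 = k ^ 2 := by
    rw [show ((2 * k + 1 : ℤ) + 0 - 1) ^ 2 = 4 * k ^ 2 by ring]
    omega
  simp only [Symbol.rank, Finset.sum_empty, Finset.card_range, Finset.card_empty]
  push_cast at h ⊢
  rw [hq]
  linarith

theorem rank_range_right (k : ℕ) :
    Symbol.rank ⟨∅, Finset.range (2 * k)⟩ = (k ^ 2 : ℤ) := by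
  have h := sum_range_intCast_mul_two (2 * k)
  have hq : (0 + (2 * k : ℤ) - 1) ^ 2 / 4 = k ^ 2 - k := by
    rw [show (0 + (2 * k : ℤ) - 1) ^ 2 = 4 * (k ^ 2 - k) + 1 by ring]
    omega
  simp only [Symbol.rank, Finset.sum_empty, Finset.card_range, Finset.card_empty]
  push_cast at h ⊢
  rw [hq]
  linarith

/-- For even `k`, with `Λ = ({2k,…,0}; ∅)`, `M = (∅; {2k−1,…,0})` and
`N = (∅; {2k+1,…,0})`: the ranks are `k(k+1)`, `k²`, `(k+1)²`, the defects are
`2k+1`, `−2k`, `−(2k+2)`, and `(Λ, M) ∈ B^+_{k(k+1),k²}`,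
`(Λ, N) ∈ B^−_{k(k+1),(k+1)²}`. -/
theorem statement18 (k : ℕ) (hk : Even k) :
    Symbol.rank ⟨Finset.range (2 * k + 1), ∅⟩ = (k * (k + 1) : ℤ) ∧
    Symbol.defect ⟨Finset.range (2 * k + 1), ∅⟩ = (2 * k + 1 : ℤ) ∧
    Symbol.rank ⟨∅, Finset.range (2 * k)⟩ = (k ^ 2 : ℤ) ∧
    Symbol.defect ⟨∅, Finset.range (2 * k)⟩ = -(2 * k : ℤ) ∧
    Symbol.rank ⟨∅, Finset.range (2 * k + 2)⟩ = ((k + 1) ^ 2 : ℤ) ∧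
    Symbol.defect ⟨∅, Finset.range (2 * k + 2)⟩ = -(2 * k + 2 : ℤ) ∧
    BPlus (k * (k + 1)) (k ^ 2) ⟨Finset.range (2 * k + 1), ∅⟩ ⟨∅, Finset.range (2 * k)⟩ ∧
    BMinus (k * (k + 1)) ((k + 1) ^ 2) ⟨Finset.range (2 * k + 1), ∅⟩
      ⟨∅, Finset.range (2 * k + 2)⟩ := by
  have hM := rank_range_right k
  have hN : Symbol.rank ⟨∅, Finset.range (2 * k + 2)⟩ = ((k + 1) ^ 2 : ℤ) := by
    simpa [mul_add] using rank_range_right (k + 1)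
  have hL := rank_range_left k
  refine ⟨hL, ?_, hM, ?_, hN, ?_, ⟨?_, ?_, ?_, ?_, ?_⟩, ⟨?_, ?_, ?_, ?_, ?_⟩⟩
  all_goals
    first
    | (simp only [upsFun_range, upsFun_empty]; exact prec_refl _)
    | (push_cast; assumption)
    | (simp only [Symbol.defect, Finset.card_range, Finset.card_empty]; push_cast; ring)

end GGP
end
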